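/- arXiv:2109.07213 — 2 statements merged into one kernel-verified Lean document; each statement's English description precedes it below -/
import Mathlib

section
/- Let A > 0, B > 0 and 0 < Γ < A²/(4B), and set μ₋ = (A − √(A² − 4BΓ))/(2B). If 0 < δ ≤ 1/A and μ₀ ∈ (0, μ₋], then the price iteration μ_{k+1} = μ_k − δ(Aμ_k − Bμ_k² − Γ) produces a nondecreasing sequence contained in (0, μ₋] that converges to μ₋. -/
open Filter Topology

/-- **Convergence of the consumers' benchmark-price iteration.**
Let `A > 0`, `B > 0`, `0 < Γ < A²/(4B)` and
`μ₋ = (A - √(A² - 4BΓ))/(2B)`. If `0 < δ ≤ 1/A` and `μ₀ ∈ (0, μ₋]`, then the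
iteration `μ_{k+1} = μ_k - δ (A μ_k - B μ_k² - Γ)` is nondecreasing, stays in
`(0, μ₋]`, and converges to `μ₋`. -/
theorem consumer_price_iteration_converges
    (A B Γ δ : ℝ) (hA : 0 < A) (hB : 0 < B)
    (hΓ : 0 < Γ) (hΓ' : Γ < A ^ 2 / (4 * B))
    (μminus : ℝ)
    (hμminus : μminus = (A - Real.sqrt (A ^ 2 - 4 * B * Γ)) / (2 * B))
    (hδ : 0 < δ) (hδ' : δ ≤ 1 / A)
    (μ : ℕ → ℝ)
    (hμ0 : 0 < μ 0 ∧ μ 0 ≤ μminus)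
    (hiter : ∀ k : ℕ, μ (k + 1) = μ k - δ * (A * μ k - B * (μ k) ^ 2 - Γ)) :
    Monotone μ ∧
    (∀ k : ℕ, 0 < μ k ∧ μ k ≤ μminus) ∧
    Tendsto μ atTop (𝓝 μminus) := by
  have hdisc : 0 < A ^ 2 - 4 * B * Γ := by
    rw [lt_div_iff₀ (by positivity)] at hΓ'
    linarith
  have hsqrt := Real.sqrt_pos.mpr hdisc
  have hsq := Real.sq_sqrt hdisc.le
  have hr : √(A ^ 2 - 4 * B * Γ) = A - 2 * B * μminus := by
    rw [hμminus]
    field_simp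
    ring
  rw [hr] at hsqrt hsq
  have hroot : A * μminus - B * μminus ^ 2 = Γ := by
    have h : (4 * B) * (A * μminus - B * μminus ^ 2) = (4 * B) * Γ := by linarith
    exact mul_left_cancel₀ (by positivity) h
  have hfactor (x : ℝ) :
      A * x - B * x ^ 2 - Γ = -((μminus - x) * (A - B * (μminus + x))) := by
    rw [← hroot]
    ring
  have hslope {x : ℝ} (hx : x ≤ μminus) : 0 < A - B * (μminus + x) := by
    have := mul_le_mul_of_nonneg_left hx hB.le
    linarith
  have hδA : δ * A ≤ 1 := (le_div_iff₀ hA).mp hδ'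
  have hstep {k : ℕ} (hk : μ k ≤ μminus) : μ k ≤ μ (k + 1) := by
    have := mul_nonneg hδ.le (mul_nonneg (sub_nonneg.mpr hk) (hslope hk).le)
    rw [hiter, hfactor]
    linarith
  have hbound (k : ℕ) : 0 < μ k ∧ μ k ≤ μminus := by
    induction k with
    | zero => exact hμ0
    | succ k ih =>
      obtain ⟨hpos, hle⟩ := ih
      refine ⟨hpos.trans_le (hstep hle), ?_⟩
      have hcontr : 0 ≤ 1 - δ * (A - B * (μminus + μ k)) := by
        have : 0 ≤ δ * (B * (μminus + μ k)) :=
          mul_nonneg hδ.le (mul_nonneg hB.le (by linarith))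
        linarith
      have := mul_nonneg (sub_nonneg.mpr hle) hcontr
      rw [hiter, hfactor]
      linarith
  have hmono : Monotone μ := monotone_nat_of_le_succ fun k => hstep (hbound k).2
  refine ⟨hmono, hbound, ?_⟩
  have hlim := tendsto_atTop_ciSup hmono
    ⟨μminus, Set.forall_mem_range.mpr fun k => (hbound k).2⟩
  generalize (⨆ k, μ k) = L at hlim
  have hL : L ≤ μminus := le_of_tendsto' hlim fun k => (hbound k).2
  have hnext : Tendsto (fun k => μ (k + 1)) atTop
      (𝓝 (L - δ * (A * L - B * L ^ 2 - Γ))) := by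
    simp only [hiter]
    exact hlim.sub ((((hlim.const_mul A).sub ((hlim.pow 2).const_mul B)).sub_const Γ).const_mul δ)
  have hfix := tendsto_nhds_unique (hlim.comp (tendsto_add_atTop_nat 1)) hnext
  have hzero : δ * ((μminus - L) * (A - B * (μminus + L))) = 0 := by
    rw [hfactor] at hfix
    linarith
  have hLm : μminus = L := by
    simpa [hδ.ne', (hslope hL).ne', sub_eq_zero] using hzero
  rwa [hLm]
end

section
/- Let A' ≥ 0, B' > 0 and Γ > 0, and set μ* = (A' + √(A'² + 4B'Γ))/(2B'). If 0 < δ ≤ 1/√(A'² + 4B'Γ) and μ₀ ∈ [0, μ*], then the price iteration μ_{k+1} = μ_k − δ(B'μ_k² − A'μ_k − Γ) produces a nondecreasing sequence contained in [0, μ*] that converges to μ*. -/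
open Filter Topology

/-- **Convergence of the producers' benchmark-price iteration.**
Let `A' ≥ 0`, `B' > 0`, `Γ > 0` and `μ* = (A' + √(A'² + 4B'Γ))/(2B')`. If
`0 < δ ≤ 1/√(A'² + 4B'Γ)` and `μ₀ ∈ [0, μ*]`, then the iteration
`μ_{k+1} = μ_k - δ (B' μ_k² - A' μ_k - Γ)` is nondecreasing, stays in
`[0, μ*]`, and converges to `μ*`. -/
theorem producer_price_iteration_converges
    (A' B' Γ δ : ℝ) (hA' : 0 ≤ A') (hB' : 0 < B') (hΓ : 0 < Γ)
    (μstar : ℝ)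
    (hμstar : μstar = (A' + Real.sqrt (A' ^ 2 + 4 * B' * Γ)) / (2 * B'))
    (hδ : 0 < δ) (hδ' : δ ≤ 1 / Real.sqrt (A' ^ 2 + 4 * B' * Γ))
    (μ : ℕ → ℝ)
    (hμ0 : 0 ≤ μ 0 ∧ μ 0 ≤ μstar)
    (hiter : ∀ k : ℕ, μ (k + 1) = μ k - δ * (B' * (μ k) ^ 2 - A' * μ k - Γ)) :
    Monotone μ ∧
    (∀ k : ℕ, 0 ≤ μ k ∧ μ k ≤ μstar) ∧
    Tendsto μ atTop (𝓝 μstar) := by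
  obtain ⟨s, hs⟩ : ∃ s, s = Real.sqrt (A' ^ 2 + 4 * B' * Γ) := ⟨_, rfl⟩
  rw [← hs] at hμstar hδ'
  have hBΓ : 0 < B' * Γ := mul_pos hB' hΓ
  have hs_sq : s ^ 2 = A' ^ 2 + 4 * B' * Γ := by
    rw [hs]
    exact Real.sq_sqrt (by nlinarith [sq_nonneg A'])
  have hA's : A' < s := by
    rw [hs]
    exact Real.lt_sqrt_of_sq_lt (by linarith)
  have hs_pos : 0 < s := hA'.trans_lt hA's
  have hδs : δ * s ≤ 1 := (le_div_iff₀ hs_pos).mp hδ'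
  have hroot : 2 * (B' * μstar) = A' + s := by
    rw [hμstar]
    field_simp
  have hquad : B' * μstar ^ 2 - A' * μstar = Γ := by
    apply mul_left_cancel₀ hB'.ne'
    have h : B' * μstar = (A' + s) / 2 := by linarith
    calc B' * (B' * μstar ^ 2 - A' * μstar)
        = (B' * μstar) * (B' * μstar) - A' * (B' * μstar) := by ring
      _ = (s ^ 2 - A' ^ 2) / 4 := by rw [h]; ring
      _ = B' * Γ := by rw [hs_sq]; ring
  obtain ⟨r, hr⟩ : ∃ r, r = B' * μstar - A' := ⟨_, rfl⟩
  have hr_pos : 0 < r := by linarith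
  have herror (k : ℕ) :
      μstar - μ (k + 1) = (1 - δ * (B' * μ k + r)) * (μstar - μ k) := by
    rw [hiter, hr, ← hquad]
    ring
  have hfactor {x : ℝ} (hx : x ≤ μstar) : δ * (B' * x + r) ≤ 1 := by
    have h : B' * x ≤ B' * μstar := by gcongr
    exact (mul_le_mul_of_nonneg_left (by linarith) hδ.le).trans hδs
  have hstep {k : ℕ} (h0 : 0 ≤ μ k) (h1 : μ k ≤ μstar) : μ k ≤ μ (k + 1) := by
    have h : 0 ≤ δ * (B' * μ k + r) * (μstar - μ k) :=
      mul_nonneg (by positivity) (sub_nonneg.mpr h1)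
    linarith [herror k]
  have hbound (k : ℕ) : 0 ≤ μ k ∧ μ k ≤ μstar := by
    induction k with
    | zero => exact hμ0
    | succ k ih =>
      refine ⟨ih.1.trans (hstep ih.1 ih.2), sub_nonneg.mp ?_⟩
      rw [herror]
      exact mul_nonneg (sub_nonneg.mpr (hfactor ih.2)) (sub_nonneg.mpr ih.2)
  refine ⟨monotone_nat_of_le_succ fun k => hstep (hbound k).1 (hbound k).2, hbound, ?_⟩
  have hrate : 0 ≤ 1 - δ * r := by
    simpa using hfactor (hμ0.1.trans hμ0.2)
  have hgeom (k : ℕ) : μstar - μ k ≤ (1 - δ * r) ^ k * (μstar - μ 0) := by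
    induction k with
    | zero => simp
    | succ k ih =>
      have h : 0 ≤ δ * (B' * μ k) := mul_nonneg hδ.le (mul_nonneg hB'.le (hbound k).1)
      calc μstar - μ (k + 1) = (1 - δ * (B' * μ k + r)) * (μstar - μ k) := herror k
        _ ≤ (1 - δ * r) * (μstar - μ k) :=
          mul_le_mul_of_nonneg_right (by linarith) (sub_nonneg.mpr (hbound k).2)
        _ ≤ (1 - δ * r) * ((1 - δ * r) ^ k * (μstar - μ 0)) :=
          mul_le_mul_of_nonneg_left ih hrate
        _ = (1 - δ * r) ^ (k + 1) * (μstar - μ 0) := by ring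
  have hpow : Tendsto (fun k => μstar - (1 - δ * r) ^ k * (μstar - μ 0)) atTop (𝓝 μstar) := by
    have h := tendsto_pow_atTop_nhds_zero_of_lt_one hrate (by linarith [mul_pos hδ hr_pos])
    simpa using (h.mul_const (μstar - μ 0)).const_sub μstar
  exact tendsto_of_tendsto_of_tendsto_of_le_of_le hpow tendsto_const_nhds
    (fun k => by linarith [hgeom k]) (fun k => (hbound k).2)
end
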